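/- For any finite multigraph G (possibly with loops) and any d ≥ 1, the multivariate d-matching polynomial μ_{d,G}(x) = E_{H ∈ C_{d,G}} μ_H(x), the uniform average of multivariate matching polynomials over all d-sheeted coverings H of G, is a stable polynomial. -/

import Mathlib

open MvPolynomial Finset
open scoped Classical

/-- A polynomial is stable if it does not vanish when all variables lie in the
open upper half-plane (the zero polynomial is stable by convention). -/
def IsStable {α : Type*} (f : MvPolynomial α ℂ) : Prop :=
  f = 0 ∨ ∀ x : α → ℂ, (∀ i, 0 < (x i).im) → MvPolynomial.eval x f ≠ 0

variable {n m d : ℕ}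

/-- A finite multigraph `G` on vertex set `Fin n`, with (undirected) edges indexed by
`Fin m`; the edge `e` joins `hd e` to `tl e` (loops, `hd e = tl e`, are allowed, as are
parallel edges).  Given a labeling `σ : Fin m → S_d` of the edges by permutations, the
`d`-sheeted covering graph `H_σ` has vertex set `Fin n × Fin d`, and for each edge `e`
of `G` and each `k`, an edge joining `(hd e, k)` to `(tl e, σ e k)`.  Edges of the
covering are thus indexed by pairs `(e, k)`; this gives the endpoints of such a pair. -/
def endpoints (hd tl : Fin m → Fin n) (σ : Fin m → Equiv.Perm (Fin d))
    (p : Fin m × Fin d) : Finset (Fin n × Fin d) :=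
  {(hd p.1, p.2), (tl p.1, (σ p.1) p.2)}

/-- `M` is a matching of the covering graph `H_σ`: a set of non-loop edges of `H_σ`,
no two of which share a vertex. -/
def IsCovMatching (hd tl : Fin m → Fin n) (σ : Fin m → Equiv.Perm (Fin d))
    (M : Finset (Fin m × Fin d)) : Prop :=
  (∀ p ∈ M, ¬(hd p.1 = tl p.1 ∧ (σ p.1) p.2 = p.2)) ∧
    ∀ p ∈ M, ∀ q ∈ M, p ≠ q → Disjoint (endpoints hd tl σ p) (endpoints hd tl σ q)

/-- The multivariate matching polynomial of the covering graph `H_σ`. -/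
noncomputable def covMatchPoly (hd tl : Fin m → Fin n)
    (σ : Fin m → Equiv.Perm (Fin d)) : MvPolynomial (Fin n × Fin d) ℂ :=
  ∑ M ∈ Finset.univ.filter (fun M => IsCovMatching hd tl σ M),
    (-1 : MvPolynomial (Fin n × Fin d) ℂ) ^ M.card *
      ∏ v ∈ Finset.univ \ M.biUnion (endpoints hd tl σ), X v

/-- The multivariate `d`-matching polynomial of `G`: the uniform average of the
multivariate matching polynomials of the `d`-sheeted coverings of `G`. -/
noncomputable def dMatchPoly (hd tl : Fin m → Fin n) (d : ℕ) :
    MvPolynomial (Fin n × Fin d) ℂ :=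
  (Fintype.card (Fin m → Equiv.Perm (Fin d)) : ℂ)⁻¹ •
    ∑ σ : Fin m → Equiv.Perm (Fin d), covMatchPoly hd tl σ


lemma ls_pert (α β γ δ : ℂ)
    (h : ∀ x y : ℂ, 0 < x.im → (0 < y.im ∨ y = 0) → α + β * x + y * (γ + δ * x) ≠ 0)
    (x : ℂ) (hx : 0 < x.im) (h0 : γ + δ * x = 0) : δ = 0 := by
  by_contra hδ
  set c := α + β * x with hc
  have hcne : c ≠ 0 := by
    have := h x 0 hx (Or.inr rfl)
    simpa using this
  -- choose `T` large
  obtain ⟨T, hT1, hT2, hT3⟩ : ∃ T : ℝ, 0 < T ∧ ‖β / δ‖ < T ∧ ‖c / δ‖ / x.im < T := by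
    refine ⟨max 0 (max ‖β / δ‖ (‖c / δ‖ / x.im)) + 1, by positivity, ?_, ?_⟩
    · exact lt_of_le_of_lt ((le_max_left _ _).trans (le_max_right _ _)) (lt_add_one _)
    · exact lt_of_le_of_lt ((le_max_right _ _).trans (le_max_right _ _)) (lt_add_one _)
  have hTc : (T : ℂ) ≠ 0 := by exact_mod_cast hT1.ne'
  set ε : ℂ := -(c / δ) / (T * Complex.I) with hε
  have hεne : ε ≠ 0 := by
    rw [hε]
    simp [hcne, hδ, hTc]
  have hεn : ‖ε‖ < x.im := by
    rw [hε, norm_div, norm_neg, norm_mul, Complex.norm_I, Complex.norm_real, mul_one,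
      Real.norm_of_nonneg hT1.le]
    rw [div_lt_iff₀ hx] at hT3
    rw [div_lt_iff₀ hT1]
    linarith
  have h1 : 0 < (x + ε).im := by
    have := (abs_le.1 (Complex.abs_im_le_norm ε)).1
    simp only [Complex.add_im]
    linarith
  have h2 : 0 < ((T : ℂ) * Complex.I - β / δ).im := by
    have := (abs_le.1 (Complex.abs_im_le_norm (β / δ))).2
    simp only [Complex.sub_im, Complex.mul_im, Complex.ofReal_re, Complex.I_im, Complex.ofReal_im,
      Complex.I_re]
    linarith
  apply h _ _ h1 (Or.inl h2)
  have e1 : γ + δ * (x + ε) = δ * ε := by linear_combination h0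
  have e2 : δ * ε * (T * Complex.I) = - c := by
    rw [hε]; field_simp [Complex.I_ne_zero]
  rw [e1]
  have e3 : δ * (β / δ) = β := by field_simp
  linear_combination e2 - ε * e3

lemma ls_two (α β γ δ : ℂ)
    (h : ∀ x y : ℂ, 0 < x.im → (0 < y.im ∨ y = 0) → α + β * x + y * (γ + δ * x) ≠ 0)
    (x : ℂ) (hx : 0 < x.im) : α + β * x - δ ≠ 0 := by
  have hf0 : α + β * x ≠ 0 := by simpa using h x 0 hx (Or.inr rfl)
  by_cases hδ : δ = 0
  · simpa [hδ] using hf0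
  intro hz
  have e : α + β * x = δ := by linear_combination hz
  set κ : ℂ := (γ + δ * x) / δ with hκ
  have hk : γ + δ * x = δ * κ := by rw [hκ]; field_simp
  by_cases hi : κ.im ≤ 0
  · apply hδ
    apply ls_pert α β γ δ h (x - κ)
    · simp only [Complex.sub_im]; linarith
    · linear_combination hk
  · push Not at hi
    have hk0 : κ ≠ 0 := by rintro h; simp [h] at hi
    refine h x (-κ⁻¹) hx (Or.inl ?_) ?_
    · rw [Complex.neg_im, Complex.inv_im]
      have := Complex.normSq_pos.2 hk0
      rw [neg_div, neg_neg]; positivity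
    · rw [e, hk]; field_simp; ring

section iter
variable {V I ι : Type*} [Fintype V] [Fintype I] [Fintype ι] [DecidableEq V] [DecidableEq I]

noncomputable def wt (v : I → V) (L : Finset I) (x : V → ℂ) : ℂ :=
  if Set.InjOn v L then (-1) ^ L.card * ∏ u ∈ Finset.univ \ L.image v, x u else 0

lemma wt_insert_update (v : I → V) (L : Finset I) (x : V → ℂ) (i : I) (s : ℂ) :
    wt v (insert i L) (Function.update x (v i) s) = wt v (insert i L) x := by
  unfold wt
  split_ifs with h
  · congr 1
    apply Finset.prod_congr rfl
    intro u hu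
    rw [Function.update_of_ne]
    rintro rfl
    simp at hu
  · rfl

lemma wt_affine (v : I → V) (L : Finset I) (x : V → ℂ) (a : V) :
    ∃ A B : ℂ, ∀ s, wt v L (Function.update x a s) = A + B * s := by
  unfold wt
  split_ifs with h
  · by_cases ha : a ∈ Finset.univ \ L.image v
    · refine ⟨0, (-1) ^ L.card * ∏ u ∈ (Finset.univ \ L.image v).erase a, x u, fun s => ?_⟩
      rw [← Finset.mul_prod_erase _ _ ha, Function.update_self]
      rw [Finset.prod_congr rfl (g := x)]
      · ring
      · intro u hu
        rw [Function.update_of_ne (Finset.ne_of_mem_erase hu)]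
    · refine ⟨(-1) ^ L.card * ∏ u ∈ (Finset.univ \ L.image v), x u, 0, fun s => ?_⟩
      rw [Finset.prod_congr rfl (g := x)]
      · ring
      · intro u hu
        rw [Function.update_of_ne]
        rintro rfl
        exact ha hu
  · exact ⟨0, 0, by simp⟩

lemma wt_deriv (v : I → V) (L : Finset I) (x : V → ℂ) (i : I) (hi : i ∉ L) :
    ∃ A : ℂ, ∀ s, wt v L (Function.update x (v i) s) = A + (- wt v (insert i L) x) * s := by
  by_cases hL : Set.InjOn v L
  · by_cases ha : v i ∈ L.image v
    · have h2 : ¬ Set.InjOn v (insert i L : Finset I) := by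
        intro h
        obtain ⟨j, hj, hji⟩ := Finset.mem_image.1 ha
        have := h (by simp [hj]) (by simp) hji
        exact hi (this ▸ hj)
      refine ⟨wt v L x, fun s => ?_⟩
      have : wt v (insert i L) x = 0 := by unfold wt; rw [if_neg h2]
      rw [this]
      have h3 : wt v L (Function.update x (v i) s) = wt v L x := by
        unfold wt
        rw [if_pos hL, if_pos hL]
        congr 1
        apply Finset.prod_congr rfl
        intro u hu
        rw [Function.update_of_ne]
        rintro rfl
        simp only [Finset.mem_sdiff] at hu
        exact hu.2 ha
      rw [h3]; ring
    · have h2 : Set.InjOn v (insert i L : Finset I) := by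
        rw [Finset.coe_insert, Set.injOn_insert (by simpa using hi)]
        exact ⟨hL, by simpa using ha⟩
      refine ⟨0, fun s => ?_⟩
      unfold wt
      rw [if_pos hL, if_pos h2, Finset.card_insert_of_notMem hi]
      have hm : v i ∈ Finset.univ \ L.image v := by simpa using ha
      rw [← Finset.mul_prod_erase _ _ hm, Function.update_self]
      have he : Finset.univ \ (insert i L).image v = (Finset.univ \ L.image v).erase (v i) := by
        ext u; simp only [Finset.image_insert, Finset.mem_sdiff, Finset.mem_univ, true_and,
          Finset.mem_insert, Finset.mem_erase]; tauto
      rw [he, Finset.prod_congr rfl (g := x)]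
      · ring
      · intro u hu
        rw [Function.update_of_ne (Finset.ne_of_mem_erase hu)]
  · have h2 : ¬ Set.InjOn v (insert i L : Finset I) := fun h => hL (h.mono (by simp))
    refine ⟨0, fun s => ?_⟩
    unfold wt
    rw [if_neg hL, if_neg h2]; ring

lemma iter_step (v : I → V) (p : ι → ℂ) (K : ι → Finset I) (J : Finset I) (i : I) (hi : i ∉ J)
    (h : ∀ (x : V → ℂ) (y : I → ℂ), (∀ u, 0 < (x u).im) → (∀ j, 0 < (y j).im ∨ y j = 0) →
      ∑ k, p k * ((∏ j ∈ K k \ J, y j) * wt v (K k ∩ J) x) ≠ 0)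
    (x : V → ℂ) (y : I → ℂ) (hx : ∀ u, 0 < (x u).im) (hy : ∀ j, 0 < (y j).im ∨ y j = 0) :
    ∑ k, p k * ((∏ j ∈ K k \ insert i J, y j) * wt v (K k ∩ insert i J) x) ≠ 0 := by
  have key : ∀ k, ∃ α β γ δ : ℂ, (∀ s t, (∏ j ∈ K k \ J, Function.update y i t j) *
      wt v (K k ∩ J) (Function.update x (v i) s) = α + β * s + t * (γ + δ * s)) ∧
      (∏ j ∈ K k \ insert i J, y j) * wt v (K k ∩ insert i J) x = α + β * x (v i) - δ := by
    intro k
    by_cases hk : i ∈ K k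
    · have e1 : K k ∩ insert i J = insert i (K k ∩ J) := by
        ext j; simp only [Finset.mem_inter, Finset.mem_insert]
        constructor
        · tauto
        · rintro (rfl | h) <;> tauto
      have e2 : K k \ insert i J = (K k \ J).erase i := by
        ext j; simp only [Finset.mem_sdiff, Finset.mem_insert, Finset.mem_erase]; tauto
      obtain ⟨A, hA⟩ := wt_deriv v (K k ∩ J) x i (by simp [hi])
      refine ⟨0, 0, (∏ j ∈ (K k \ J).erase i, y j) * A,
        (∏ j ∈ (K k \ J).erase i, y j) * (- wt v (insert i (K k ∩ J)) x), ?_, ?_⟩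
      · intro s t
        have hm : i ∈ K k \ J := by simp [hk, hi]
        rw [hA, ← Finset.mul_prod_erase _ _ hm, Function.update_self,
          Finset.prod_congr rfl (g := y)]
        · ring
        · intro u hu
          rw [Function.update_of_ne (Finset.ne_of_mem_erase hu)]
      · rw [e1, e2]; ring
    · have e1 : K k ∩ insert i J = K k ∩ J := by
        ext j; simp only [Finset.mem_inter, Finset.mem_insert]
        constructor
        · rintro ⟨h, (rfl | h')⟩ <;> tauto
        · tauto
      have e2 : K k \ insert i J = K k \ J := by
        ext j; simp only [Finset.mem_sdiff, Finset.mem_insert]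
        constructor
        · tauto
        · rintro ⟨h, h'⟩
          refine ⟨h, ?_⟩
          rintro (rfl | h'') <;> tauto
      obtain ⟨A, B, hA⟩ := wt_affine v (K k ∩ J) x (v i)
      refine ⟨(∏ j ∈ K k \ J, y j) * A, (∏ j ∈ K k \ J, y j) * B, 0, 0, ?_, ?_⟩
      · intro s t
        rw [hA, Finset.prod_congr rfl (g := y)]
        · ring
        · intro u hu
          rw [Function.update_of_ne]
          rintro rfl
          simp [hk] at hu
      · rw [e1, e2]
        have := hA (x (v i))
        rw [Function.update_eq_self] at this
        rw [this]; ring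
  choose α β γ δ h1 h2 using key
  have := ls_two (∑ k, p k * α k) (∑ k, p k * β k) (∑ k, p k * γ k) (∑ k, p k * δ k) ?_
    (x (v i)) (hx _)
  · convert this using 1
    rw [Finset.sum_mul, ← Finset.sum_add_distrib, ← Finset.sum_sub_distrib]
    refine Finset.sum_congr rfl fun k _ => ?_
    rw [h2]; ring
  · intro s t hs ht
    have := h (Function.update x (v i) s) (Function.update y i t) ?_ ?_
    · convert this using 1
      rw [Finset.sum_mul, Finset.sum_mul, ← Finset.sum_add_distrib, ← Finset.sum_add_distrib,
        Finset.mul_sum, ← Finset.sum_add_distrib]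
      refine Finset.sum_congr rfl fun k _ => ?_
      rw [h1]; ring
    · intro u
      rcases eq_or_ne u (v i) with rfl | hu
      · simpa using hs
      · simpa [Function.update_of_ne hu] using hx u
    · intro u
      rcases eq_or_ne u i with rfl | hu
      · simpa using ht
      · simpa [Function.update_of_ne hu] using hy u

lemma iter_all (v : I → V) (p : ι → ℂ) (K : ι → Finset I)
    (h : ∀ (y : I → ℂ), (∀ j, 0 < (y j).im ∨ y j = 0) → ∑ k, p k * ∏ j ∈ K k, y j ≠ 0)
    (x : V → ℂ) (hx : ∀ u, 0 < (x u).im) :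
    ∑ k, p k * wt v (K k) x ≠ 0 := by
  have main : ∀ J : Finset I, ∀ (x : V → ℂ) (y : I → ℂ), (∀ u, 0 < (x u).im) →
      (∀ j, 0 < (y j).im ∨ y j = 0) →
      ∑ k, p k * ((∏ j ∈ K k \ J, y j) * wt v (K k ∩ J) x) ≠ 0 := by
    intro J
    induction J using Finset.induction_on with
    | empty =>
      intro x y hx hy
      have hw : wt v ∅ x ≠ 0 := by
        unfold wt
        rw [if_pos (by simp)]
        simp only [Finset.card_empty, pow_zero, one_mul]
        refine Finset.prod_ne_zero_iff.2 fun u _ h0 => ?_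
        have := hx u
        simp [h0] at this
      have := mul_ne_zero (h y hy) hw
      rw [Finset.sum_mul] at this
      simpa [mul_assoc] using this
    | insert i J hi ih => exact iter_step v p K J i hi ih
  have := main Finset.univ x 0 hx (by simp)
  have e : ∀ k, K k \ Finset.univ = ∅ := fun k =>
    Finset.sdiff_eq_empty_iff_subset.2 (Finset.subset_univ _)
  simpa only [e, Finset.prod_empty, one_mul, Finset.inter_univ] using this

end iter

noncomputable def polarOp (d : ℕ) (w : ℂ) : Polynomial ℂ →ₗ[ℂ] Polynomial ℂ :=
  (d : ℂ) • LinearMap.id +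
    (LinearMap.mulLeft ℂ (Polynomial.C w - Polynomial.X)).comp Polynomial.derivative

lemma polarOp_apply (d : ℕ) (w : ℂ) (p : Polynomial ℂ) :
    polarOp d w p = (d : ℂ) • p + (Polynomial.C w - Polynomial.X) * Polynomial.derivative p := rfl

lemma polarOp_natDegree (d : ℕ) (w : ℂ) (p : Polynomial ℂ) (hp : p.natDegree ≤ d + 1) :
    (polarOp (d + 1) w p).natDegree ≤ d := by
  rw [Polynomial.natDegree_le_iff_coeff_eq_zero] at hp ⊢
  intro N hN
  obtain ⟨N, rfl⟩ : ∃ k, N = k + 1 := ⟨N - 1, by omega⟩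
  rw [polarOp_apply, sub_mul]
  simp only [Polynomial.coeff_add, Polynomial.coeff_smul, Polynomial.coeff_sub,
    Polynomial.coeff_C_mul, Polynomial.coeff_X_mul, Polynomial.coeff_derivative, smul_eq_mul]
  rw [hp (N + 1 + 1) (by omega)]
  rcases Nat.lt_or_ge d N with h | h
  · rw [hp (N + 1) (by omega)]; simp
  · obtain rfl : N = d := by omega
    push_cast; ring

lemma sum_lin_lt (ℓ : ℂ →+ ℝ) (c : ℝ) (s : Multiset ℂ) (hs : ∀ u ∈ s, ℓ u < c) (h0 : s ≠ 0) :
    ℓ s.sum < s.card * c := by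
  have h1 : ∀ s : Multiset ℂ, (∀ u ∈ s, ℓ u < c) → ℓ s.sum ≤ s.card * c := by
    intro s
    induction s using Multiset.induction_on with
    | empty => simp
    | cons a s ih =>
      intro h
      have := ih fun u hu => h u (Multiset.mem_cons_of_mem hu)
      have := h a (Multiset.mem_cons_self _ _)
      simp only [Multiset.sum_cons, map_add, Multiset.card_cons]
      push_cast
      linarith
  induction s using Multiset.induction_on with
  | empty => simp at h0
  | cons a s ih =>
    have := h1 s fun u hu => hs u (Multiset.mem_cons_of_mem hu)
    have := hs a (Multiset.mem_cons_self _ _)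
    simp only [Multiset.sum_cons, map_add, Multiset.card_cons]
    push_cast
    linarith

noncomputable def tang (y : ℝ) (u0 : ℂ) : ℂ →+ ℝ where
  toFun u := 2 * y * (u0.re * u.re + u0.im * u.im) + u.im
  map_zero' := by simp
  map_add' a b := by simp; ring

lemma gval (z w : ℂ) (h : z - w ≠ 0) :
    z.im * Complex.normSq (1 / (z - w)) + (1 / (z - w)).im = w.im / Complex.normSq (z - w) := by
  have := (Complex.normSq_pos.2 h).ne'
  rw [one_div, Complex.normSq_inv, Complex.inv_im, Complex.sub_im]
  field_simp
  ring

lemma polarOp_ne (d : ℕ) (w : ℂ) (hw : 0 ≤ w.im) (p : Polynomial ℂ) (hd : p.natDegree ≤ d + 1)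
    (hp : ∀ z : ℂ, 0 ≤ z.im → p.eval z ≠ 0) (z : ℂ) (hz : 0 ≤ z.im) :
    (polarOp (d + 1) w p).eval z ≠ 0 := by
  rw [polarOp_apply]
  simp only [Polynomial.eval_add, Polynomial.eval_smul, Polynomial.eval_mul, Polynomial.eval_sub,
    Polynomial.eval_C, Polynomial.eval_X, smul_eq_mul]
  intro h
  have hpz := hp z hz
  have hd0 : ((d + 1 : ℕ) : ℂ) ≠ 0 := by exact_mod_cast Nat.succ_ne_zero d
  have hzw : z - w ≠ 0 := by
    intro e
    have : w - z = 0 := by linear_combination -e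
    rw [this, zero_mul, add_zero] at h
    exact (mul_ne_zero hd0 hpz) h
  have hsp : p.Splits := IsAlgClosed.splits p
  have hsum := hsp.eval_derivative_div_eval_of_ne_zero hpz
  set s : Multiset ℂ := p.roots.map fun r => 1 / (z - r) with hs
  have hu : ((d + 1 : ℕ) : ℂ) * (1 / (z - w)) = s.sum := by
    rw [← hsum]
    field_simp
    linear_combination h
  set u0 := 1 / (z - w) with hu0
  have hs0 : s ≠ 0 := by
    intro e
    rw [e, Multiset.sum_zero] at hu
    exact mul_ne_zero hd0 (one_div_ne_zero hzw) hu
  have hcard : (s.card : ℝ) ≤ (d + 1 : ℕ) := by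
    have : s.card ≤ d + 1 := by
      rw [hs, Multiset.card_map]
      exact (Polynomial.card_roots' p).trans hd
    exact_mod_cast this
  have hlt := sum_lin_lt (tang z.im u0) (z.im * Complex.normSq u0) s ?_ hs0
  · rw [← hu] at hlt
    have e1 : tang z.im u0 (((d + 1 : ℕ) : ℂ) * u0) = (d + 1 : ℕ) * tang z.im u0 u0 := by
      rw [← nsmul_eq_mul, map_nsmul, nsmul_eq_mul]
    have e2 : tang z.im u0 u0 = z.im * Complex.normSq u0 + w.im / Complex.normSq (z - w) := by
      rw [← gval z w hzw, ← hu0]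
      simp only [tang, AddMonoidHom.coe_mk, ZeroHom.coe_mk, Complex.normSq_apply]
      ring
    rw [e1, e2] at hlt
    have h3 : 0 ≤ w.im / Complex.normSq (z - w) := div_nonneg hw (Complex.normSq_nonneg _)
    have h4 : 0 ≤ z.im * Complex.normSq u0 := mul_nonneg hz (Complex.normSq_nonneg _)
    have h5 := mul_le_mul_of_nonneg_right hcard h4
    have h6 : (0:ℝ) ≤ (d + 1 : ℕ) * (w.im / Complex.normSq (z - w)) := by positivity
    linarith
  · intro u hu
    obtain ⟨r, hr, rfl⟩ := Multiset.mem_map.1 hu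
    have hr0 : p.eval r = 0 := (Polynomial.isRoot_of_mem_roots hr)
    have hri : r.im < 0 := by
      by_contra hc
      exact hp r (not_lt.1 hc) hr0
    have hzr : z - r ≠ 0 := by
      intro e
      have : z = r := by linear_combination e
      exact hpz (this ▸ hr0)
    have g := gval z r hzr
    have : r.im / Complex.normSq (z - r) < 0 := div_neg_of_neg_of_pos hri (Complex.normSq_pos.2 hzr)
    set u := 1 / (z - r)
    have h7 := mul_nonneg hz (Complex.normSq_nonneg (u - u0))
    simp only [tang, AddMonoidHom.coe_mk, ZeroHom.coe_mk]
    simp only [Complex.normSq_apply, Complex.sub_re, Complex.sub_im] at *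
    nlinarith

noncomputable def polarEval : (d : ℕ) → (Fin d → ℂ) → (Polynomial ℂ →ₗ[ℂ] ℂ)
  | 0, _ => Polynomial.leval 0
  | d + 1, b => (polarEval d (Fin.tail b)).comp (polarOp (d + 1) (b 0))

lemma polarEval_ne (d : ℕ) (b : Fin d → ℂ) (hb : ∀ i, 0 ≤ (b i).im) (p : Polynomial ℂ)
    (hd : p.natDegree ≤ d) (hp : ∀ z : ℂ, 0 ≤ z.im → p.eval z ≠ 0) : polarEval d b p ≠ 0 := by
  induction d generalizing p with
  | zero => exact hp 0 (by simp)
  | succ d ih =>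
    exact ih (Fin.tail b) (fun i => hb _) _ (polarOp_natDegree d _ p hd)
      (polarOp_ne d _ (hb 0) p hd hp)

lemma polarOp_prod (d : ℕ) (w : ℂ) (a : Fin d → ℂ) :
    polarOp d w (∏ k, (1 - Polynomial.C (a k) * Polynomial.X)) =
      ∑ k, (1 - a k * w) • ∏ l ∈ Finset.univ.erase k, (1 - Polynomial.C (a l) * Polynomial.X) := by
  rw [polarOp_apply, Polynomial.derivative_prod_finset, Finset.mul_sum]
  have : ((d : ℂ) • ∏ k, (1 - Polynomial.C (a k) * Polynomial.X) : Polynomial ℂ) =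
      ∑ _j : Fin d, ∏ k, (1 - Polynomial.C (a k) * Polynomial.X) := by
    rw [Finset.sum_const, Finset.card_univ, Fintype.card_fin, ← Nat.cast_smul_eq_nsmul ℂ]
  rw [this, ← Finset.sum_add_distrib]
  refine Finset.sum_congr rfl fun k _ => ?_
  rw [← Finset.mul_prod_erase _ _ (Finset.mem_univ k), Polynomial.smul_eq_C_mul]
  simp only [Polynomial.derivative_sub, Polynomial.derivative_one, Polynomial.derivative_mul,
    Polynomial.derivative_C, Polynomial.derivative_X, Polynomial.C_sub, Polynomial.C_mul,
    Polynomial.C_1]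
  ring

lemma polarEval_prod (d : ℕ) (a b : Fin d → ℂ) :
    polarEval d b (∏ k, (1 - Polynomial.C (a k) * Polynomial.X)) =
      ∑ σ : Equiv.Perm (Fin d), ∏ k, (1 - b k * a (σ k)) := by
  induction d with
  | zero => simp [polarEval]
  | succ d ih =>
    rw [polarEval, LinearMap.comp_apply, polarOp_prod, map_sum,
      ← Equiv.Perm.decomposeFin.symm.sum_comp, Fintype.sum_prod_type]
    refine Finset.sum_congr rfl fun k _ => ?_
    rw [map_smul, smul_eq_mul]
    have : ∏ l ∈ Finset.univ.erase k, (1 - Polynomial.C (a l) * Polynomial.X) =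
        ∏ i : Fin d, (1 - Polynomial.C (a (Equiv.swap 0 k i.succ)) * Polynomial.X) := by
      symm
      refine Finset.prod_bij (fun i _ => Equiv.swap 0 k i.succ) ?_ ?_ ?_ ?_
      · intro i _
        simp only [Finset.mem_erase, Finset.mem_univ, and_true]
        intro h
        have h' : Equiv.swap 0 k i.succ = Equiv.swap 0 k 0 := by rw [h, Equiv.swap_apply_left]
        exact Fin.succ_ne_zero i ((Equiv.swap 0 k).injective h')
      · intro i _ j _ h
        exact Fin.succ_injective _ ((Equiv.swap 0 k).injective h)
      · intro l hl
        have : Equiv.swap 0 k l ≠ 0 := by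
          intro h
          have : l = k := by
            have := congrArg (Equiv.swap 0 k) h
            simpa using this
          simp [this] at hl
        obtain ⟨i, hi⟩ := Fin.exists_succ_eq.2 this
        exact ⟨i, Finset.mem_univ _, by rw [hi]; simp⟩
      · intros; rfl
    rw [this, ih (fun i => a (Equiv.swap 0 k i.succ)) (Fin.tail b), Finset.mul_sum]
    refine Finset.sum_congr rfl fun σ _ => ?_
    rw [Fin.prod_univ_succ]
    simp only [Equiv.Perm.decomposeFin_symm_apply_zero, Equiv.Perm.decomposeFin_symm_apply_succ,
      Fin.tail]
    ring

lemma perm_sum_ne (d : ℕ) (a b : Fin d → ℂ) (ha : ∀ k, 0 < (a k).im ∨ a k = 0)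
    (hb : ∀ k, 0 < (b k).im ∨ b k = 0) :
    ∑ σ : Equiv.Perm (Fin d), ∏ k, (1 - b k * a (σ k)) ≠ 0 := by
  rw [← polarEval_prod]
  apply polarEval_ne
  · intro i
    rcases hb i with h | h
    · exact h.le
    · simp [h]
  · refine (Polynomial.natDegree_prod_le _ _).trans ?_
    calc _ ≤ ∑ _i : Fin d, 1 := Finset.sum_le_sum fun i _ => by
            compute_degree
      _ = d := by simp
  · intro z hz
    rw [Polynomial.eval_prod]
    refine Finset.prod_ne_zero_iff.2 fun k _ => ?_
    simp only [Polynomial.eval_sub, Polynomial.eval_one, Polynomial.eval_mul, Polynomial.eval_C,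
      Polynomial.eval_X]
    intro h
    rcases ha k with h' | h'
    · have e : a k * z = 1 := by linear_combination -h
      have ha0 : a k ≠ 0 := by rintro h0; simp [h0] at h'
      have e2 : z = (a k)⁻¹ := by field_simp; linear_combination e
      rw [e2, Complex.inv_im] at hz
      have : -(a k).im / Complex.normSq (a k) < 0 :=
        div_neg_of_neg_of_pos (by linarith) (Complex.normSq_pos.2 ha0)
      linarith
    · simp [h'] at h

/-- The index set of the new variables used by a matching `M` in the cover `σ`. -/
noncomputable def kset (k : (Fin m → Equiv.Perm (Fin d)) × Finset (Fin m × Fin d)) :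
    Finset ((Fin m × Fin d) ⊕ (Fin m × Fin d)) :=
  k.2.disjSum (k.2.image fun p => (p.1, k.1 p.1 p.2))

lemma kphi_inj (σ : Fin m → Equiv.Perm (Fin d)) :
    Function.Injective (fun p : Fin m × Fin d => (p.1, σ p.1 p.2)) := by
  rintro ⟨e, k⟩ ⟨e', k'⟩ h
  simp only [Prod.mk.injEq] at h
  obtain ⟨rfl, h⟩ := h
  simpa using h

def vmap (hd tl : Fin m → Fin n) : (Fin m × Fin d) ⊕ (Fin m × Fin d) → Fin n × Fin d :=
  Sum.elim (fun p => (hd p.1, p.2)) (fun p => (tl p.1, p.2))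

lemma kset_image (hd tl : Fin m → Fin n) (σ : Fin m → Equiv.Perm (Fin d))
    (M : Finset (Fin m × Fin d)) :
    (kset (σ, M)).image (vmap hd tl) = M.biUnion (endpoints hd tl σ) := by
  ext u
  simp only [kset, Finset.mem_image, Finset.mem_disjSum, Finset.mem_biUnion, endpoints,
    Finset.mem_insert, Finset.mem_singleton]
  constructor
  · rintro ⟨i, (⟨p, hp, rfl⟩ | ⟨q, ⟨p, hp, rfl⟩, rfl⟩), rfl⟩
    · exact ⟨p, hp, Or.inl rfl⟩
    · exact ⟨p, hp, Or.inr rfl⟩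
  · rintro ⟨p, hp, rfl | rfl⟩
    · exact ⟨Sum.inl p, Or.inl ⟨p, hp, rfl⟩, rfl⟩
    · exact ⟨Sum.inr (p.1, σ p.1 p.2), Or.inr ⟨_, ⟨p, hp, rfl⟩, rfl⟩, rfl⟩

lemma kset_injOn (hd tl : Fin m → Fin n) (σ : Fin m → Equiv.Perm (Fin d))
    (M : Finset (Fin m × Fin d)) :
    Set.InjOn (vmap hd tl) (kset (σ, M) : Set ((Fin m × Fin d) ⊕ (Fin m × Fin d))) ↔ IsCovMatching hd tl σ M := by
  have ml : ∀ p, Sum.inl p ∈ (kset (σ, M) : Set ((Fin m × Fin d) ⊕ (Fin m × Fin d))) ↔ p ∈ M := by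
    intro p; simp [kset]
  have mr : ∀ p, p ∈ M → Sum.inr (p.1, σ p.1 p.2) ∈ (kset (σ, M) : Set ((Fin m × Fin d) ⊕ (Fin m × Fin d))) := by
    intro p hp
    simp only [kset, Finset.mem_coe, Finset.inr_mem_disjSum, Finset.mem_image]
    exact ⟨p, hp, rfl⟩
  have mr' : ∀ q, Sum.inr q ∈ (kset (σ, M) : Set ((Fin m × Fin d) ⊕ (Fin m × Fin d))) → ∃ p ∈ M, (p.1, σ p.1 p.2) = q := by
    intro q hq
    simpa only [kset, Finset.mem_coe, Finset.inr_mem_disjSum, Finset.mem_image] using hq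
  constructor
  · intro h
    refine ⟨?_, ?_⟩
    · rintro p hp ⟨h1, h2⟩
      have := h ((ml p).2 hp) (mr p hp) (by simp [vmap, h1, h2])
      simp at this
    · intro p hp q hq hpq
      rw [Finset.disjoint_left]
      intro u hu hu'
      simp only [endpoints, Finset.mem_insert, Finset.mem_singleton] at hu hu'
      rcases hu with rfl | rfl <;> rcases hu' with hu' | hu'
      · have := h ((ml p).2 hp) ((ml q).2 hq) hu'
        exact hpq (Sum.inl_injective this)
      · have := h ((ml p).2 hp) (mr q hq) hu'
        simp at this
      · have := h (mr p hp) ((ml q).2 hq) hu'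
        simp at this
      · have := h (mr p hp) (mr q hq) hu'
        exact hpq (kphi_inj σ (Sum.inr_injective this))
  · rintro ⟨h1, h2⟩
    have key : ∀ p ∈ M, ∀ q ∈ M, ∀ u, u ∈ endpoints hd tl σ p → u ∈ endpoints hd tl σ q →
        p = q := by
      intro p hp q hq u hu hu'
      by_contra hpq
      exact Finset.disjoint_left.1 (h2 p hp q hq hpq) hu hu'
    have el : ∀ p, (hd p.1, p.2) ∈ endpoints hd tl σ p := by intro p; simp [endpoints]
    have er : ∀ p, (tl p.1, σ p.1 p.2) ∈ endpoints hd tl σ p := by intro p; simp [endpoints]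
    have mix : ∀ p ∈ M, ∀ q ∈ M, (hd p.1, p.2) ≠ (tl q.1, σ q.1 q.2) := by
      intro p hp q hq e
      have := key p hp q hq _ (el p) (e ▸ er q)
      subst this
      simp only [Prod.mk.injEq] at e
      exact h1 p hp ⟨e.1, e.2.symm⟩
    rintro (p | p) hp (q | q) hq e
    · rw [ml] at hp hq
      have e' : (hd p.1, p.2) = (hd q.1, q.2) := e
      rw [key p hp q hq _ (el p) (e' ▸ el q)]
    · rw [ml] at hp
      obtain ⟨q, hqM, rfl⟩ := mr' _ hq
      exact (mix p hp q hqM e).elim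
    · rw [ml] at hq
      obtain ⟨p, hpM, rfl⟩ := mr' _ hp
      exact (mix q hq p hpM e.symm).elim
    · obtain ⟨p, hpM, rfl⟩ := mr' _ hp
      obtain ⟨q, hqM, rfl⟩ := mr' _ hq
      have e' : (tl p.1, σ p.1 p.2) = (tl q.1, σ q.1 q.2) := e
      rw [key p hpM q hqM _ (er p) (e' ▸ er q)]

lemma kset_wt (hd tl : Fin m → Fin n) (σ : Fin m → Equiv.Perm (Fin d))
    (M : Finset (Fin m × Fin d)) (x : Fin n × Fin d → ℂ) :
    wt (vmap hd tl) (kset (σ, M)) x = if IsCovMatching hd tl σ M then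
      ∏ u ∈ Finset.univ \ M.biUnion (endpoints hd tl σ), x u else 0 := by
  unfold wt
  simp only [kset_injOn, kset_image]
  split_ifs
  · have : (kset (σ, M)).card = 2 * M.card := by
      rw [kset, Finset.card_disjSum, Finset.card_image_of_injective _ (kphi_inj σ)]
      ring
    rw [this, pow_mul]; simp
  · rfl

/-- For any finite multigraph (possibly with loops and parallel edges) and any `d ≥ 1`,
the multivariate `d`-matching polynomial is stable. -/
theorem stmt_8 (hd tl : Fin m → Fin n) (d : ℕ) (hd1 : 1 ≤ d) :
    IsStable (dMatchPoly hd tl d) := by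
  right
  intro x hx
  have main := iter_all (vmap hd tl)
    (fun k : (Fin m → Equiv.Perm (Fin d)) × Finset (Fin m × Fin d) => (-1 : ℂ) ^ k.2.card)
    kset ?_ x hx
  · rw [dMatchPoly, MvPolynomial.smul_eval, map_sum]
    refine mul_ne_zero (inv_ne_zero ?_) ?_
    · exact_mod_cast Fintype.card_ne_zero
    · convert main using 1
      rw [Fintype.sum_prod_type]
      refine Finset.sum_congr rfl fun σ _ => ?_
      rw [covMatchPoly, map_sum, Finset.sum_filter]
      refine Finset.sum_congr rfl fun M _ => ?_
      rw [kset_wt]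
      split_ifs <;> simp
  · intro y hy
    have h := fun e : Fin m => perm_sum_ne d (fun k => y (Sum.inr (e, k)))
      (fun k => y (Sum.inl (e, k))) (fun k => hy _) (fun k => hy _)
    have h2 := Finset.prod_ne_zero_iff.2 fun (e : Fin m) (_ : e ∈ Finset.univ) => h e
    rw [Fintype.prod_sum] at h2
    convert h2 using 1
    rw [Fintype.sum_prod_type]
    refine Finset.sum_congr rfl fun σ _ => ?_
    rw [← Fintype.prod_prod_type' (f := fun e k =>
      (1 - y (Sum.inl (e, k)) * y (Sum.inr (e, σ e k))))]
    simp only [sub_eq_add_neg]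
    rw [Finset.prod_one_add, Finset.powerset_univ]
    refine Finset.sum_congr rfl fun M _ => ?_
    rw [kset, Finset.prod_disjSum, Finset.prod_image (fun _ _ _ _ e => kphi_inj σ e),
      ← Finset.prod_mul_distrib, Finset.prod_neg]
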